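/- Suppose f : ℝ^d → ℝ is real-valued with f̂ ∈ L¹(ℝ^d), ‖f‖_{B^{1,log}} < ∞ and ‖f‖_{B¹} > 0. For any compact set Ω ⊂ [0,1]^d and any m ∈ ℕ, there exists a single ReLU network F : ℝ^d → ℝ of width d+4 and depth at most 6m·‖f‖_{B^{1,log}}/‖f‖_{B¹} such that ‖f − F‖_{H¹(Ω)} ≤ (4π²/√m)·|Ω|^{1/2}·‖f‖_{B¹}. -/

import Mathlib

open MeasureTheory Real Filter

noncomputable section

/-- The ℓ¹ norm on `ℝ^d`. -/
def l1 {d : ℕ} (ξ : Fin d → ℝ) : ℝ := ∑ i, |ξ i|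

/-- The Fourier transform `f̂(ξ) = ∫ f(x) e^{-2πi ξ·x} dx`. -/
def fhat {d : ℕ} (f : (Fin d → ℝ) → ℂ) (ξ : Fin d → ℝ) : ℂ :=
  ∫ x : Fin d → ℝ,
    Complex.exp (-(2 * (Real.pi : ℂ) * Complex.I * ((∑ i, ξ i * x i : ℝ) : ℂ))) * f x

/-- Fourier transform of a real-valued function. -/
def fhatR {d : ℕ} (f : (Fin d → ℝ) → ℝ) : (Fin d → ℝ) → ℂ :=
  fhat (fun x => (f x : ℂ))

/-- log-Barron norm `∫ log₂(2+‖ξ‖₁)|g(ξ)| dξ` of a frequency-side function `g`. -/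
def logBarron {d : ℕ} (g : (Fin d → ℝ) → ℂ) : ℝ :=
  ∫ ξ : Fin d → ℝ, Real.logb 2 (2 + l1 ξ) * ‖g ξ‖

/-- Barron norm of order 0 : `∫ (1 + ‖ξ‖₁⁰)|g(ξ)| dξ = 2∫|g(ξ)|dξ`. -/
def B0 {d : ℕ} (g : (Fin d → ℝ) → ℂ) : ℝ := 2 * ∫ ξ : Fin d → ℝ, ‖g ξ‖

/-- Barron norm of order 1 : `∫ (1 + ‖ξ‖₁)|g(ξ)| dξ`. -/
def B1 {d : ℕ} (g : (Fin d → ℝ) → ℂ) : ℝ := ∫ ξ : Fin d → ℝ, (1 + l1 ξ) * ‖g ξ‖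

/-- first-order log-Barron norm `∫ (1+‖ξ‖₁) log₂(2+‖ξ‖₁)|g(ξ)| dξ`. -/
def B1log {d : ℕ} (g : (Fin d → ℝ) → ℂ) : ℝ :=
  ∫ ξ : Fin d → ℝ, (1 + l1 ξ) * Real.logb 2 (2 + l1 ξ) * ‖g ξ‖

/-- One hidden ReLU layer `z ↦ ReLU(Wz+b)`. -/
def reluLayer {N : ℕ} (W : Matrix (Fin N) (Fin N) ℝ) (b : Fin N → ℝ) (z : Fin N → ℝ) :
    Fin N → ℝ :=
  fun i => max 0 (W.mulVec z i + b i)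

/-- Iterate `k` hidden layers. -/
def hiddenIter {N : ℕ} (W : ℕ → Matrix (Fin N) (Fin N) ℝ) (b : ℕ → Fin N → ℝ) :
    ℕ → (Fin N → ℝ) → (Fin N → ℝ)
  | 0, z => z
  | k + 1, z => reluLayer (W k) (b k) (hiddenIter W b k z)

/-- `F : ℝ^d → ℝ` is a ReLU network of width `N` and depth `L`:
`F(x) = W_L z_{L-1}`, `z₀ = x`, `z_l = ReLU(W_l z_{l-1} + b_l)` for `1 ≤ l ≤ L-1`. -/
def IsReLUNet (d N L : ℕ) (F : (Fin d → ℝ) → ℝ) : Prop :=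
  ∃ (W₁ : Matrix (Fin N) (Fin d) ℝ) (b₁ : Fin N → ℝ)
    (W : ℕ → Matrix (Fin N) (Fin N) ℝ) (b : ℕ → Fin N → ℝ) (Wout : Fin N → ℝ),
    ∀ x, F x = ∑ i, Wout i *
      hiddenIter W b (L - 2) (fun j => max 0 (W₁.mulVec x j + b₁ j)) i

/-- `v` is the `j`-th weak partial derivative of `u` on `Ω`. -/
def HasWeakPartial {d : ℕ} (Ω : Set (Fin d → ℝ)) (u : (Fin d → ℝ) → ℝ) (j : Fin d)
    (v : (Fin d → ℝ) → ℝ) : Prop :=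
  ∀ φ : (Fin d → ℝ) → ℝ, ContDiff ℝ (⊤ : ℕ∞) φ → HasCompactSupport φ → tsupport φ ⊆ interior Ω →
    ∫ x in Ω, u x * fderiv ℝ φ x (Pi.single j 1) = - ∫ x in Ω, v x * φ x

/-- Euclidean diameter of a set in `ℝ^d`. -/
def eucDiam {d : ℕ} (Ω : Set (Fin d → ℝ)) : ℝ :=
  sSup {r : ℝ | ∃ x ∈ Ω, ∃ y ∈ Ω, r = Real.sqrt (∑ i, (x i - y i) ^ 2)}


open scoped FourierTransform RealInnerProductSpace ContDiff in
lemma inv_ae_V {V : Type*} [NormedAddCommGroup V] [InnerProductSpace ℝ V] [FiniteDimensional ℝ V]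
    [MeasurableSpace V] [BorelSpace V] (f : V → ℂ) (hf : Integrable f) (hf' : Integrable (𝓕 f)) :
    ∀ᵐ x, f x = 𝓕⁻ (𝓕 f) x := by
  have hcont : Continuous (𝓕⁻ (𝓕 f)) := by
    have h1 : Continuous (𝓕 (𝓕 f)) :=
      VectorFourier.fourierIntegral_continuous Real.continuous_fourierChar
        (by exact continuous_inner) hf'
    have : 𝓕⁻ (𝓕 f) = fun x => 𝓕 (𝓕 f) (-x) := by
      ext x; exact Real.fourierInv_eq_fourier_neg _ _
    rw [this]; exact h1.comp continuous_neg
  refine ae_eq_of_integral_contDiff_smul_eq hf.locallyIntegrable hcont.locallyIntegrable ?_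
  intro g hg hgc
  have hgc' : HasCompactSupport (fun x => (g x : ℂ)) := hgc.comp_left (g := fun r : ℝ => (r : ℂ)) (by simp)
  have hg' : ContDiff ℝ ∞ (fun x => (g x : ℂ)) := Complex.ofRealCLM.contDiff.comp hg
  set φ : SchwartzMap V ℂ := hgc'.toSchwartzMap hg' with hφ
  have hφx : ∀ x, φ x = (g x : ℂ) := fun x => rfl
  have e1 : ∫ ξ, 𝓕 (𝓕⁻ (φ : V → ℂ)) ξ * f ξ = ∫ x, (𝓕⁻ (φ : V → ℂ)) x * 𝓕 f x := by
    have := VectorFourier.integral_fourierIntegral_smul_eq_flip (L := innerₗ V) (μ := volume)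
      (ν := volume) (f := (𝓕⁻ φ : SchwartzMap V ℂ)) (g := f) Real.continuous_fourierChar
      (by exact continuous_inner) (𝓕⁻ φ : SchwartzMap V ℂ).integrable hf
    rw [flip_innerₗ] at this
    rw [SchwartzMap.fourierInv_coe] at this
    exact this
  have e0 : 𝓕 (𝓕⁻ (φ : V → ℂ)) = (φ : V → ℂ) := by
    rw [← SchwartzMap.fourierInv_coe, ← SchwartzMap.fourier_coe,
      FourierTransform.fourier_fourierInv_eq]
  have key : ∀ h : V → ℂ, 𝓕⁻ h = VectorFourier.fourierIntegral 𝐞 volume (-innerₗ V) h := by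
    intro h; ext x; rw [Real.fourierInv_eq]; simp [VectorFourier.fourierIntegral]
  have e2 : ∫ ξ, (𝓕⁻ (φ : V → ℂ)) ξ * 𝓕 f ξ = ∫ x, φ x * 𝓕⁻ (𝓕 f) x := by
    have := VectorFourier.integral_fourierIntegral_smul_eq_flip (L := -innerₗ V) (μ := volume)
      (ν := volume) (f := φ) (g := 𝓕 f) Real.continuous_fourierChar
      (by exact continuous_inner.neg) φ.integrable hf'
    have h2 : (-innerₗ V).flip = -innerₗ V := by
      ext x y; simp [real_inner_comm]
    rw [h2, ← key, ← key] at this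
    exact this
  rw [e0, e2] at e1
  simpa [hφx] using e1

lemma fhat_ne_integrable {d : ℕ} (f : (Fin d → ℝ) → ℝ) (hB1 : 0 < B1 (fhatR f)) :
    Integrable (fun x => (f x : ℂ)) := by
  by_contra hf
  have h0 : ∀ ξ, fhatR f ξ = 0 := by
    intro ξ
    apply integral_undef
    intro h
    apply hf
    have hc : Continuous (fun x : Fin d → ℝ =>
      Complex.exp ((2 * (Real.pi : ℂ) * Complex.I * ((∑ i, ξ i * x i : ℝ) : ℂ)))) := by fun_prop
    have h3 := h.bdd_mul (c := 1) hc.aestronglyMeasurable (by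
      filter_upwards with x
      rw [show 2 * (Real.pi : ℂ) * Complex.I * ((∑ i, ξ i * x i : ℝ) : ℂ) =
        ((2 * Real.pi * (∑ i, ξ i * x i) : ℝ) : ℂ) * Complex.I by push_cast; ring]
      rw [Complex.norm_exp_ofReal_mul_I])
    refine h3.congr ?_
    filter_upwards with x
    rw [← mul_assoc, ← Complex.exp_add]; simp
  simp [B1, h0] at hB1

open scoped FourierTransform in
lemma fhat_eq_fourier {d : ℕ} (f : (Fin d → ℝ) → ℂ) (ξ : Fin d → ℝ) :
    fhat f ξ = 𝓕 (fun y : EuclideanSpace ℝ (Fin d) => f y.ofLp) (WithLp.toLp 2 ξ) := by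
  rw [Real.fourier_eq', ← (PiLp.volume_preserving_toLp (Fin d)).integral_comp
    (MeasurableEquiv.toLp 2 (Fin d → ℝ)).measurableEmbedding]
  unfold fhat
  congr 1 with x
  simp only [smul_eq_mul]
  congr 2
  simp [PiLp.inner_apply]
  ring

open scoped FourierTransform in
lemma fhat_cont {d : ℕ} (f : (Fin d → ℝ) → ℂ) (hf : Integrable f) : Continuous (fhat f) := by
  have : fhat f = fun ξ =>
    𝓕 (fun y : EuclideanSpace ℝ (Fin d) => f y.ofLp) (WithLp.toLp 2 ξ) := by
    ext ξ; exact fhat_eq_fourier f ξ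
  rw [this]
  have h1 : Integrable (fun y : EuclideanSpace ℝ (Fin d) => f y.ofLp) :=
    ((PiLp.volume_preserving_ofLp (Fin d)).integrable_comp_emb
      (MeasurableEquiv.toLp 2 (Fin d → ℝ)).symm.measurableEmbedding).2 hf
  exact (VectorFourier.fourierIntegral_continuous Real.continuous_fourierChar
        (by exact continuous_inner) h1).comp (PiLp.continuous_toLp 2 _)

open scoped FourierTransform in
lemma inv_ae {d : ℕ} (f : (Fin d → ℝ) → ℂ) (hf : Integrable f) (hf' : Integrable (fhat f)) :
    ∀ᵐ x, f x = ∫ ξ : Fin d → ℝ,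
      Complex.exp (2 * (Real.pi : ℂ) * Complex.I * ((∑ i, ξ i * x i : ℝ) : ℂ)) * fhat f ξ := by
  have h1 : Integrable (fun y : EuclideanSpace ℝ (Fin d) => f y.ofLp) :=
    ((PiLp.volume_preserving_ofLp (Fin d)).integrable_comp_emb
      (MeasurableEquiv.toLp 2 (Fin d → ℝ)).symm.measurableEmbedding).2 hf
  have h2 : Integrable (𝓕 (fun y : EuclideanSpace ℝ (Fin d) => f y.ofLp)) := by
    rw [← (PiLp.volume_preserving_toLp (Fin d)).integrable_comp_emb
      (MeasurableEquiv.toLp 2 (Fin d → ℝ)).measurableEmbedding]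
    refine hf'.congr ?_
    filter_upwards with ξ
    exact fhat_eq_fourier f ξ
  have h3 := inv_ae_V _ h1 h2
  have h4 := (PiLp.volume_preserving_toLp (Fin d)).quasiMeasurePreserving.ae h3
  filter_upwards [h4] with x hx
  rw [show f x = f (WithLp.toLp 2 x).ofLp from rfl, hx, Real.fourierInv_eq',
    ← (PiLp.volume_preserving_toLp (Fin d)).integral_comp
    (MeasurableEquiv.toLp 2 (Fin d → ℝ)).measurableEmbedding]
  congr 1 with ξ
  rw [fhat_eq_fourier]
  simp only [smul_eq_mul]
  congr 2
  simp [PiLp.inner_apply]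
  have : ∀ i, (x i : ℂ) * ξ i = ξ i * x i := fun i => mul_comm _ _
  simp only [this]
  ring

def tent (v : ℝ) : ℝ := 2 * max 0 v - 4 * max 0 (v - 1 / 2)

def gfun (n : ℕ) (s t : ℝ) : ℝ :=
  1 - Real.pi ^ 2 * Real.cos (Real.pi * s) * max 0 (tent^[n + 1] (t / 2 ^ n) - s)

lemma tent_le_one (v : ℝ) : tent v ≤ 1 := by
  unfold tent
  rcases max_cases 0 v with h | h <;> rcases max_cases 0 (v - 1/2) with h' | h' <;> linarith

lemma tent_mem {v : ℝ} (h0 : 0 ≤ v) (h1 : v ≤ 1) : 0 ≤ tent v := by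
  unfold tent
  rcases max_cases 0 v with h | h <;> rcases max_cases 0 (v - 1/2) with h' | h' <;> linarith

lemma tent_iter_le_one (n : ℕ) (v : ℝ) : tent^[n + 1] v ≤ 1 := by
  rw [Function.iterate_succ_apply']; exact tent_le_one _

lemma tent_iter_mem (n : ℕ) {v : ℝ} (h0 : 0 ≤ v) (h1 : v ≤ 1) :
    0 ≤ tent^[n] v ∧ tent^[n] v ≤ 1 := by
  induction n with
  | zero => exact ⟨h0, h1⟩
  | succ n ih =>
    rw [Function.iterate_succ_apply']
    exact ⟨tent_mem ih.1 ih.2, tent_le_one _⟩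

lemma cos_tent {v : ℝ} (h0 : 0 ≤ v) (h1 : v ≤ 1) (k : ℕ) :
    Real.cos (Real.pi * k * tent v) = Real.cos (Real.pi * k * (2 * v)) := by
  rcases le_total v (1/2) with h | h
  · rw [tent, max_eq_right h0, max_eq_left (by linarith)]; ring_nf
  · rw [tent, max_eq_right h0, max_eq_right (by linarith)]
    rw [← Real.cos_neg, ← Real.cos_add_nat_mul_two_pi _ k]
    ring_nf

lemma cos_tent_iter (n : ℕ) {v : ℝ} (h0 : 0 ≤ v) (h1 : v ≤ 1) :
    Real.cos (Real.pi * tent^[n] v) = Real.cos (Real.pi * (2 ^ n * v)) := by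
  induction n with
  | zero => simp
  | succ n ih =>
    have := tent_iter_mem n h0 h1
    have key : ∀ (n : ℕ) (v : ℝ), 0 ≤ v → v ≤ 1 →
        Real.cos (Real.pi * tent^[n] v) = Real.cos (Real.pi * (2 ^ n * v)) := by
      intro n
      induction n with
      | zero => intros; simp
      | succ n ih =>
        intro v h0 h1
        rw [Function.iterate_succ_apply, ih _ (tent_mem h0 h1) (tent_le_one _)]
        have := cos_tent h0 h1 (2 ^ n)
        push_cast at this
        rw [← mul_assoc, this]; ring_nf
    exact key (n + 1) v h0 h1

lemma cos_gw (n : ℕ) {t : ℝ} (h0 : 0 ≤ t) (h1 : t ≤ 2 ^ n) :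
    Real.cos (Real.pi * tent^[n + 1] (t / 2 ^ n)) = Real.cos (2 * Real.pi * t) := by
  rw [cos_tent_iter (n + 1) (by positivity) ((div_le_one (by positivity)).2 h1)]
  congr 1
  field_simp
  ring

lemma gfun_bound (n : ℕ) {s : ℝ} (hs : 0 ≤ s) (t : ℝ) : |gfun n s t| ≤ 1 + Real.pi ^ 2 := by
  unfold gfun
  have h1 := Real.abs_cos_le_one (Real.pi * s)
  have h2 : |max 0 (tent^[n + 1] (t / 2 ^ n) - s)| ≤ 1 := by
    rw [abs_of_nonneg (le_max_left _ _)]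
    have := tent_iter_le_one n (t / 2 ^ n)
    exact max_le zero_le_one (by linarith)
  refine (abs_sub _ _).trans ?_
  rw [abs_one, abs_mul, abs_mul, abs_of_nonneg (sq_nonneg Real.pi)]
  have h3 : |Real.cos (Real.pi * s)| * |max 0 (tent^[n + 1] (t / 2 ^ n) - s)| ≤ 1 :=
    mul_le_one₀ h1 (abs_nonneg _) h2
  nlinarith [sq_nonneg Real.pi]

lemma hiddenIter_congr {N : ℕ} (W W' : ℕ → Matrix (Fin N) (Fin N) ℝ) (b b' : ℕ → Fin N → ℝ)
    (k : ℕ) (h : ∀ i < k, W i = W' i ∧ b i = b' i) (z : Fin N → ℝ) :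
    hiddenIter W b k z = hiddenIter W' b' k z := by
  induction k with
  | zero => rfl
  | succ k ih =>
    simp only [hiddenIter]
    rw [ih (fun i hi => h i (by omega)), (h k (by omega)).1, (h k (by omega)).2]

def Reach {d : ℕ} (M : ℕ) (y : (Fin d → ℝ) → Fin 4 → ℝ) : Prop :=
  ∃ (W₁ : Matrix (Fin (d + 4)) (Fin d) ℝ) (b₁ : Fin (d + 4) → ℝ)
    (W : ℕ → Matrix (Fin (d + 4)) (Fin (d + 4)) ℝ) (b : ℕ → Fin (d + 4) → ℝ),
    ∀ x ∈ Set.Icc (0 : Fin d → ℝ) 1,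
      hiddenIter W b M (fun j => max 0 (W₁.mulVec x j + b₁ j)) = Fin.append x (y x)

lemma layer_exists {d : ℕ} (c : Fin 4 → Fin d → ℝ) (U : Fin 4 → Fin 4 → ℝ) :
    ∃ W : Matrix (Fin (d + 4)) (Fin (d + 4)) ℝ, ∀ (x : Fin d → ℝ) (y : Fin 4 → ℝ), 0 ≤ x →
      reluLayer W 0 (Fin.append x y) =
        Fin.append x (fun i => max 0 (∑ k, c i k * x k + ∑ k, U i k * y k)) := by
  refine ⟨Matrix.of (Fin.append (fun i => Fin.append (Pi.single i 1) 0)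
    (fun i => Fin.append (c i) (U i))), ?_⟩
  intro x y hx
  ext i
  refine Fin.addCases (fun i => ?_) (fun i => ?_) i
  · simp only [reluLayer, Matrix.mulVec, dotProduct, Fin.sum_univ_add, Matrix.of_apply,
      Fin.append_left, Fin.append_right]
    simp [Pi.single_apply]
    exact hx i
  · simp only [reluLayer, Matrix.mulVec, dotProduct, Fin.sum_univ_add, Matrix.of_apply,
      Fin.append_left, Fin.append_right]
    simp

lemma Reach.step {d M : ℕ} {y : (Fin d → ℝ) → Fin 4 → ℝ} (h : Reach M y)
    (c : Fin 4 → Fin d → ℝ) (U : Fin 4 → Fin 4 → ℝ) (y' : (Fin d → ℝ) → Fin 4 → ℝ)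
    (hy : ∀ x ∈ Set.Icc (0 : Fin d → ℝ) 1, ∀ i,
      y' x i = max 0 (∑ k, c i k * x k + ∑ k, U i k * y x k)) :
    Reach (M + 1) y' := by
  obtain ⟨W₁, b₁, W, b, H⟩ := h
  obtain ⟨W', hW'⟩ := layer_exists c U
  refine ⟨W₁, b₁, Function.update W M W', Function.update b M 0, fun x hx => ?_⟩
  simp only [hiddenIter, Function.update_self]
  rw [hiddenIter_congr _ W _ b M (fun i hi => by
    simp [Function.update_of_ne (show i ≠ M by omega)]), H x hx, hW' _ _ hx.1]
  congr 1
  ext i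
  exact (hy x hx i).symm

lemma reach_zero {d : ℕ} : Reach (d := d) 0 (fun _ => ![0, 0, 0, 1]) := by
  refine ⟨Matrix.of (Fin.append (fun i => Pi.single i 1) 0),
    Fin.append 0 ![0, 0, 0, 1], 0, 0, fun x hx => ?_⟩
  ext i
  simp only [hiddenIter]
  refine Fin.addCases (fun i => ?_) (fun i => ?_) i
  · simp [Matrix.mulVec, dotProduct, Pi.single_apply]
    exact hx.1 i
  · simp only [Matrix.mulVec, dotProduct, Matrix.of_apply, Fin.append_right]
    fin_cases i <;> simp

def Good {d : ℕ} (M : ℕ) (F : (Fin d → ℝ) → ℝ) : Prop :=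
  ∃ (acc a b : (Fin d → ℝ) → ℝ) (p q Bd : ℝ), Reach M (fun x => ![acc x, a x, b x, 1]) ∧
    ∀ x ∈ Set.Icc (0 : Fin d → ℝ) 1, F x = acc x + p * a x + q ∧ -Bd ≤ F x

lemma good_zero {d : ℕ} : Good (d := d) 0 (fun _ => 0) :=
  ⟨0, 0, 0, 0, 0, 0, reach_zero, by simp⟩

lemma Good.add {d M : ℕ} {F : (Fin d → ℝ) → ℝ} (h : Good M F) (n : ℕ) (ξ : Fin d → ℝ) (τ s c : ℝ)
    (hs : 0 ≤ s) :
    Good (M + (n + 2)) (fun x => F x + c * gfun n s ((∑ i, ξ i * x i) + τ)) := by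
  obtain ⟨acc, a, b, p, q, Bd, hR, hF⟩ := h
  set v : (Fin d → ℝ) → ℝ := fun x => ((∑ i, ξ i * x i) + τ) / 2 ^ n with hv
  have R1 : ∀ j, Reach (M + 1 + j) (fun x => ![F x + Bd, max 0 (tent^[j] (v x)),
      max 0 (tent^[j] (v x) - 1 / 2), 1]) := by
    intro j
    induction j with
    | zero =>
      refine hR.step ![0, fun i => ξ i / 2 ^ n, fun i => ξ i / 2 ^ n, 0]
        ![![1, p, 0, q + Bd], ![0, 0, 0, τ / 2 ^ n], ![0, 0, 0, τ / 2 ^ n - 1 / 2], ![0, 0, 0, 1]]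
        _ ?_
      intro x hx i
      have h1 : ∑ i, ξ i / 2 ^ n * x i = (∑ i, ξ i * x i) / 2 ^ n := by
        rw [Finset.sum_div]; refine Finset.sum_congr rfl fun i _ => by ring
      obtain ⟨hx1, hx2⟩ := hF x hx
      fin_cases i
      · simp [Fin.sum_univ_four]
        rw [max_eq_right] <;> linarith
      · simp [Fin.sum_univ_four, h1, hv, add_div]
      · simp [Fin.sum_univ_four, h1, hv, add_div]
        congr 1; ring
      · simp [Fin.sum_univ_four]
    | succ j ih =>
      refine ih.step 0 ![![1, 0, 0, 0], ![0, 2, -4, 0], ![0, 2, -4, -1/2], ![0, 0, 0, 1]] _ ?_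
      intro x hx i
      obtain ⟨hx1, hx2⟩ := hF x hx
      fin_cases i
      · simp [Fin.sum_univ_four]
        linarith
      · simp [Fin.sum_univ_four, Function.iterate_succ_apply']
        unfold tent; congr 1; norm_num; ring
      · simp [Fin.sum_univ_four, Function.iterate_succ_apply']
        unfold tent; congr 1; norm_num; ring
      · simp [Fin.sum_univ_four]
  have R2 : Reach (M + (n + 2)) (fun x => ![F x + Bd, max 0 (tent^[n + 1] (v x) - s), 0, 1]) := by
    rw [show M + (n + 2) = M + 1 + n + 1 by ring]
    refine (R1 n).step 0 ![![1, 0, 0, 0], ![0, 2, -4, -s], ![0, 0, 0, 0], ![0, 0, 0, 1]] _ ?_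
    intro x hx i
    obtain ⟨hx1, hx2⟩ := hF x hx
    fin_cases i
    · simp [Fin.sum_univ_four]
      linarith
    · simp [Fin.sum_univ_four, Function.iterate_succ_apply', -Function.iterate_succ]
      rw [tent]; congr 1; norm_num; ring
    · simp [Fin.sum_univ_four]
    · simp [Fin.sum_univ_four]
  refine ⟨_, _, _, -c * (Real.pi ^ 2 * Real.cos (Real.pi * s)), c - Bd,
    Bd + |c| * (1 + Real.pi ^ 2), R2, ?_⟩
  intro x hx
  constructor
  · simp only [gfun, hv]; ring
  · have h1 := gfun_bound n hs ((∑ i, ξ i * x i) + τ)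
    have h2 : |c * gfun n s ((∑ i, ξ i * x i) + τ)| ≤ |c| * (1 + Real.pi ^ 2) := by
      rw [abs_mul]; gcongr
    have := (hF x hx).2
    have := neg_le_of_abs_le h2
    linarith

lemma Good.net {d M : ℕ} {F : (Fin d → ℝ) → ℝ} (h : Good M F) (α : ℝ) :
    ∃ F', IsReLUNet d (d + 4) (M + 2) F' ∧ ∀ x ∈ Set.Icc (0 : Fin d → ℝ) 1, F' x = α * F x := by
  obtain ⟨acc, a, b, p, q, Bd, ⟨W₁, b₁, W, b', hR⟩, hF⟩ := h
  refine ⟨_, ⟨W₁, b₁, W, b', Fin.append 0 ![α, α * p, 0, α * q], fun x => rfl⟩, ?_⟩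
  intro x hx
  rw [Nat.add_sub_cancel, hR x hx, (hF x hx).1, Fin.sum_univ_add]
  simp [Fin.sum_univ_four]
  ring

lemma tent_lip : LipschitzWith 2 tent := by
  refine LipschitzWith.of_dist_le_mul fun x y => ?_
  rw [Real.dist_eq, Real.dist_eq]
  unfold tent
  simp only [NNReal.coe_ofNat]
  rcases max_cases 0 x with h | h <;> rcases max_cases 0 (x - 1/2) with h' | h' <;>
  rcases max_cases 0 y with k | k <;> rcases max_cases 0 (y - 1/2) with k' | k' <;>
  rcases abs_cases (x - y) with l | l <;> rw [abs_le] <;> constructor <;> linarith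

lemma gfun_lip (n : ℕ) (s : ℝ) :
    LipschitzWith (Real.toNNReal (2 * Real.pi ^ 2)) (gfun n s) := by
  refine LipschitzWith.of_dist_le_mul fun x y => ?_
  rw [Real.dist_eq, Real.dist_eq, Real.coe_toNNReal _ (by positivity)]
  have h1 := (tent_lip.iterate (n + 1)).dist_le_mul (x / 2 ^ n) (y / 2 ^ n)
  rw [Real.dist_eq, Real.dist_eq, ← sub_div, abs_div, abs_of_pos (show (0:ℝ) < 2 ^ n by positivity)] at h1
  have h1' : |tent^[n + 1] (x / 2 ^ n) - tent^[n + 1] (y / 2 ^ n)| ≤ 2 * |x - y| := by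
    refine h1.trans (le_of_eq ?_)
    push_cast
    field_simp
    ring
  have h2 : |max 0 (tent^[n + 1] (x / 2 ^ n) - s) - max 0 (tent^[n + 1] (y / 2 ^ n) - s)| ≤
      2 * |x - y| := by
    refine le_trans ?_ h1'
    refine (abs_max_sub_max_le_max _ _ _ _).trans ?_
    simp
  unfold gfun
  rw [show ∀ a b c : ℝ, 1 - c * a - (1 - c * b) = c * (b - a) by intros; ring, abs_mul, abs_mul,
    abs_sub_comm, abs_of_nonneg (sq_nonneg Real.pi)]
  have h3 := Real.abs_cos_le_one (Real.pi * s)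
  calc _ ≤ Real.pi ^ 2 * 1 * (2 * |x - y|) := by gcongr
    _ = _ := by ring

lemma gfun_deriv_bound (n : ℕ) (s t : ℝ) : |deriv (gfun n s) t| ≤ 2 * Real.pi ^ 2 := by
  have := norm_deriv_le_of_lipschitz (x₀ := t) (gfun_lip n s)
  rwa [Real.coe_toNNReal _ (by positivity)] at this

lemma tent_cont : Continuous tent := tent_lip.continuous

lemma gfun_cont : Continuous (Function.uncurry (fun p : ℕ × ℝ => gfun p.1 p.2)) := by
  have : Function.uncurry (fun p : ℕ × ℝ => gfun p.1 p.2) =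
    (fun q : ℕ × (ℝ × ℝ) => gfun q.1 q.2.1 q.2.2) ∘ (Homeomorph.prodAssoc ℕ ℝ ℝ) := by
    ext ⟨⟨n, s⟩, t⟩; rfl
  rw [this]
  refine Continuous.comp ?_ (Homeomorph.continuous _)
  rw [continuous_prod_of_discrete_left]
  intro n
  have := tent_cont.iterate (n + 1)
  unfold gfun
  dsimp only
  have h2 : Continuous (fun a : ℝ × ℝ => tent^[n + 1] (a.2 / 2 ^ n)) := this.comp (by fun_prop)
  fun_prop

lemma gfun_deriv_meas : Measurable (fun p : (ℕ × ℝ) × ℝ => deriv (gfun p.1.1 p.1.2) p.2) :=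
  measurable_deriv_with_param gfun_cont

lemma integral_cos_relu {w : ℝ} (h0 : 0 ≤ w) (h1 : w ≤ 1) :
    ∫ s in Set.Icc (0:ℝ) 1, (1 - Real.pi ^ 2 * Real.cos (Real.pi * s) * max 0 (w - s)) =
      Real.cos (Real.pi * w) := by
  have hc : Continuous (fun s : ℝ => 1 - Real.pi ^ 2 * Real.cos (Real.pi * s) * max 0 (w - s)) := by
    fun_prop
  rw [integral_Icc_eq_integral_Ioc, ← intervalIntegral.integral_of_le zero_le_one,
    ← intervalIntegral.integral_add_adjacent_intervals (b := w) (hc.intervalIntegrable _ _)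
      (hc.intervalIntegrable _ _)]
  have e2 : ∫ s in w..1, (1 - Real.pi ^ 2 * Real.cos (Real.pi * s) * max 0 (w - s)) = 1 - w := by
    rw [intervalIntegral.integral_congr (g := fun _ => (1:ℝ))]
    · simp
    · intro s hs
      rw [Set.uIcc_of_le h1] at hs
      simp only
      rw [max_eq_left (by linarith [hs.1])]; ring
  have e1 : ∫ s in (0:ℝ)..w, (1 - Real.pi ^ 2 * Real.cos (Real.pi * s) * max 0 (w - s)) =
      ∫ s in (0:ℝ)..w, (1 - Real.pi ^ 2 * Real.cos (Real.pi * s) * (w - s)) := by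
    apply intervalIntegral.integral_congr
    intro s hs
    rw [Set.uIcc_of_le h0] at hs
    simp only
    rw [max_eq_right (by linarith [hs.2])]
  have e3 : ∫ s in (0:ℝ)..w, (1 - Real.pi ^ 2 * Real.cos (Real.pi * s) * (w - s)) =
      (fun s => s - Real.pi * ((w - s) * Real.sin (Real.pi * s)) + Real.cos (Real.pi * s)) w -
      (fun s => s - Real.pi * ((w - s) * Real.sin (Real.pi * s)) + Real.cos (Real.pi * s)) 0 := by
    apply intervalIntegral.integral_eq_sub_of_hasDerivAt (f := fun s => s - Real.pi * ((w - s) * Real.sin (Real.pi * s)) + Real.cos (Real.pi * s))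
    · intro s _
      have hl : HasDerivAt (fun s : ℝ => Real.pi * s) Real.pi s := by
        simpa using (hasDerivAt_id s).const_mul Real.pi
      have hw : HasDerivAt (fun s : ℝ => w - s) (-1) s := (hasDerivAt_id s).const_sub w
      have := ((hasDerivAt_id s).sub ((hw.mul hl.sin).const_mul Real.pi)).add hl.cos
      refine this.congr_deriv ?_
      ring
    · apply Continuous.intervalIntegrable; fun_prop
  rw [e2, e1, e3]
  simp

lemma weak_ridge {d : ℕ} (Ω : Set (Fin d → ℝ)) (g : ℝ → ℝ) (C : NNReal) (hg : LipschitzWith C g)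
    (ξ : Fin d → ℝ) (τ c : ℝ) (j : Fin d) :
    HasWeakPartial Ω (fun x => c * g ((∑ i, ξ i * x i) + τ)) j
      (fun x => c * ξ j * deriv g ((∑ i, ξ i * x i) + τ)) := by
  intro φ hφ hφc hφΩ
  let L : (Fin d → ℝ) →ₗ[ℝ] ℝ := ∑ i, ξ i • LinearMap.proj i
  have hL : ∀ x, L x = ∑ i, ξ i * x i := by intro x; simp [L]
  have hφ0 : ∀ x, x ∉ Ω → φ x = 0 := fun x hx =>
    image_eq_zero_of_notMem_tsupport fun h => hx (interior_subset (hφΩ h))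
  have hφ1 : ∀ x, x ∉ Ω → fderiv ℝ φ x = 0 := fun x hx => by
    by_contra h
    exact hx (interior_subset (hφΩ (support_fderiv_subset ℝ (by simpa using h))))
  rw [setIntegral_eq_integral_of_forall_compl_eq_zero (fun x hx => by simp [hφ1 x hx]),
    setIntegral_eq_integral_of_forall_compl_eq_zero (fun x hx => by simp [hφ0 x hx])]
  obtain ⟨D, hD⟩ := ContDiff.lipschitzWith_of_hasCompactSupport hφc hφ (by simp)
  have hLlip : LipschitzWith ‖LinearMap.toContinuousLinearMap L‖₊ L :=
    (LinearMap.toContinuousLinearMap L).lipschitz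
  have hG : LipschitzWith (C * ‖LinearMap.toContinuousLinearMap L‖₊) (fun x => g (L x + τ)) := by
    refine LipschitzWith.of_dist_le_mul fun x y => ?_
    refine (hg.dist_le_mul _ _).trans ?_
    rw [dist_add_right, NNReal.coe_mul, mul_assoc]
    gcongr
    exact hLlip.dist_le_mul x y
  have key := hG.integral_lineDeriv_mul_eq (μ := volume) hD hφc (Pi.single j 1)
  have hae : ∀ᵐ x, lineDeriv ℝ (fun x => g (L x + τ)) x (Pi.single j 1) =
      ξ j * deriv g (L x + τ) := by
    by_cases hξ : ξ = 0
    · filter_upwards with x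
      have : L = 0 := by simp [L, hξ]
      simp [this, hξ, lineDeriv]
    · have hsurj : Function.Surjective L := by
        apply LinearMap.surjective
        intro h
        apply hξ
        ext i
        have := congrArg (fun l => l (Pi.single i 1)) h
        simpa [hL, Pi.single_apply] using this
      have h1 : ∀ᵐ t : ℝ, t ∈ {t | DifferentiableAt ℝ (fun t => g (t + τ)) t} := by
        have : LipschitzWith C (fun t => g (t + τ)) := by
          refine LipschitzWith.of_dist_le_mul fun x y => ?_
          refine (hg.dist_le_mul _ _).trans ?_
          rw [dist_add_right]
        exact this.ae_differentiableAt
      rw [← ae_comp_linearMap_mem_iff L volume volume hsurj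
        (measurableSet_of_differentiableAt ℝ _)] at h1
      filter_upwards [h1] with x hx
      have h2 : HasDerivAt (fun t => g (t + τ)) (deriv g (L x + τ)) (L x) := by
        have := hx.hasDerivAt
        rwa [deriv_comp_add_const] at this
      have h3 : HasDerivAt (fun t : ℝ => L x + t * ξ j) (ξ j) 0 := by
        simpa using ((hasDerivAt_id (0:ℝ)).mul_const (ξ j)).const_add (L x)
      have h4 : HasDerivAt ((fun t => g (t + τ)) ∘ fun t : ℝ => L x + t * ξ j)
          (deriv g (L x + τ) * ξ j) 0 :=
        HasDerivAt.comp 0 (by simpa using h2) h3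
      rw [lineDeriv, mul_comm, ← h4.deriv]
      congr 1
      ext t
      have : L (Pi.single j 1) = ξ j := by simp [hL, Pi.single_apply]
      simp [this]
  have key2 : ∫ x, lineDeriv ℝ (fun x => g (L x + τ)) x (Pi.single j 1) * φ x =
      ∫ x, ξ j * deriv g (L x + τ) * φ x := by
    apply integral_congr_ae
    filter_upwards [hae] with x hx
    rw [hx]
  rw [key2] at key
  have hφd : ∀ x, lineDeriv ℝ φ x (-Pi.single j 1) = - fderiv ℝ φ x (Pi.single j 1) := by
    intro x
    rw [((hφ.differentiable (by simp)) x).lineDeriv_eq_fderiv, map_neg]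
  simp only [hφd, neg_mul, integral_neg] at key
  simp only [← hL]
  have a1 : ∫ x, c * g (L x + τ) * fderiv ℝ φ x (Pi.single j 1) =
      c * ∫ x, fderiv ℝ φ x (Pi.single j 1) * g (L x + τ) := by
    rw [← integral_const_mul]; congr 1 with x; ring
  have a2 : ∫ x, c * ξ j * deriv g (L x + τ) * φ x =
      c * ∫ x, ξ j * deriv g (L x + τ) * φ x := by
    rw [← integral_const_mul]; congr 1 with x; ring
  rw [a1, a2, key]; ring

section greedy
variable {A X ι : Type*} [MeasurableSpace A] [MeasurableSpace X] [Fintype ι]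

lemma bdd_int {Y : Type*} [MeasurableSpace Y] (μ : Measure Y) [IsFiniteMeasure μ] (u : Y → ℝ)
    (hu : Measurable u) (C : ℝ) (hC : ∀ y, |u y| ≤ C) : Integrable u μ :=
  Integrable.of_bound hu.aestronglyMeasurable C (ae_of_all _ hC)

lemma bdd_mean (P : Measure A) [IsProbabilityMeasure P] (H : A → ℝ) (C : ℝ)
    (hC : ∀ y, |H y| ≤ C) : |∫ a, H a ∂P| ≤ C := by
  have := norm_integral_le_of_norm_le_const (μ := P) (f := H) (C := C) (ae_of_all _ hC)
  simpa using this

lemma mean_meas (P : Measure A) [IsProbabilityMeasure P] (H : A → X → ℝ)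
    (hH : Measurable (Function.uncurry H)) : Measurable (fun x => ∫ a, H a x ∂P) := by
  have : StronglyMeasurable (Function.uncurry (fun x a => H a x)) :=
    (hH.comp measurable_swap).stronglyMeasurable
  exact this.integral_prod_right.measurable

lemma step1 (P : Measure A) [IsProbabilityMeasure P] (μ : Measure X) [IsFiniteMeasure μ]
    (H : A → X → ℝ) (hH : Measurable (Function.uncurry H)) (C : ℝ) (hC : ∀ a x, |H a x| ≤ C)
    (S : X → ℝ) (hS : Measurable S) (C' : ℝ) (hC' : ∀ x, |S x| ≤ C') :
    Integrable (fun a => ∫ x, (S x + (H a x - ∫ a', H a' x ∂P)) ^ 2 ∂μ) P ∧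
    ∫ a, ∫ x, (S x + (H a x - ∫ a', H a' x ∂P)) ^ 2 ∂μ ∂P ≤
      ∫ x, S x ^ 2 ∂μ + ∫ a, ∫ x, H a x ^ 2 ∂μ ∂P := by
  set h : X → ℝ := fun x => ∫ a', H a' x ∂P with hh
  have hhm : Measurable h := mean_meas P H hH
  have hhb : ∀ x, |h x| ≤ C := fun x => bdd_mean P _ C (fun a => hC a x)
  have I1 : Integrable (Function.uncurry fun a x => (S x + (H a x - h x)) ^ 2) (P.prod μ) := by
    apply bdd_int _ _ _ ((C' + (C + C)) ^ 2)
    · rintro ⟨a, x⟩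
      simp only [Function.uncurry_apply_pair]
      rw [abs_pow]
      gcongr
      refine (abs_add_le _ _).trans (add_le_add (hC' x) ((abs_sub _ _).trans
        (add_le_add (hC a x) (hhb x))))
    · have : Measurable (fun p : A × X => H p.1 p.2) := hH
      simp only [Function.uncurry_def]
      fun_prop
  have I2 : Integrable (Function.uncurry fun a x => H a x ^ 2) (P.prod μ) := by
    apply bdd_int _ _ _ (C ^ 2)
    · rintro ⟨a, x⟩
      simp only [Function.uncurry_apply_pair]
      rw [abs_pow]
      gcongr
      exact hC a x
    · have : Measurable (fun p : A × X => H p.1 p.2) := hH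
      simp only [Function.uncurry_def]
      fun_prop
  refine ⟨I1.integral_prod_left, ?_⟩
  rw [integral_integral_swap I1, integral_integral_swap I2, ← integral_add]
  · apply integral_mono I1.integral_prod_right
    · refine Integrable.add (bdd_int _ _ (by fun_prop) (C' ^ 2) ?_) I2.integral_prod_right
      intro x
      rw [abs_pow]; gcongr; exact hC' x
    · intro x
      have hHx : Measurable (fun a => H a x) := hH.comp (by fun_prop : Measurable fun a => (a, x))
      have i1 : Integrable (fun a => H a x) P := bdd_int _ _ hHx C (fun a => hC a x)
      have i2 : Integrable (fun a => H a x ^ 2) P := bdd_int _ _ (by fun_prop) (C ^ 2) (fun a => by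
        rw [abs_pow]; gcongr; exact hC a x)
      have : ∫ a, (S x + (H a x - h x)) ^ 2 ∂P = S x ^ 2 - h x ^ 2 + ∫ a, H a x ^ 2 ∂P := by
        have e : ∀ a, (S x + (H a x - h x)) ^ 2 =
          (S x - h x) ^ 2 + (2 * (S x - h x) * H a x + H a x ^ 2) := fun a => by ring
        simp_rw [e]
        rw [integral_add (integrable_const _) (show Integrable (fun a => 2 * (S x - h x) * H a x + H a x ^ 2) P from
            (i1.const_mul _).add i2),
          integral_add (i1.const_mul _) i2, integral_const_mul]
        simp only [integral_const, probReal_univ, one_smul]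
        rw [show ∫ a, H a x ∂P = h x from rfl]; ring
      change ∫ a, (S x + (H a x - h x)) ^ 2 ∂P ≤ S x ^ 2 + ∫ a, H a x ^ 2 ∂P
      rw [this]
      nlinarith [sq_nonneg (h x)]
  · refine bdd_int _ _ (by fun_prop) (C' ^ 2) ?_
    intro x
    rw [abs_pow]; gcongr; exact hC' x
  · exact I2.integral_prod_right

lemma greedy (P : Measure A) [IsProbabilityMeasure P] (μ : Measure X) [IsFiniteMeasure μ]
    (H : ι → A → X → ℝ) (hH : ∀ i, Measurable (Function.uncurry (H i))) (C : ℝ)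
    (hC : ∀ i a x, |H i a x| ≤ C) (N : A → ℝ) (hN : Integrable N P) (α β : ℝ) (hα : 0 ≤ α)
    (m : ℕ) :
    ∃ ω : Fin m → A,
      α * ∑ i, ∫ x, (∑ k, (H i (ω k) x - ∫ a, H i a x ∂P)) ^ 2 ∂μ + β * ∑ k, N (ω k) ≤
        m * (α * ∑ i, ∫ a, ∫ x, H i a x ^ 2 ∂μ ∂P + β * ∫ a, N a ∂P) := by
  induction m with
  | zero => exact ⟨Fin.elim0, by simp⟩
  | succ m ih =>
    obtain ⟨ω, hω⟩ := ih
    have hs := fun i => step1 P μ (H i) (hH i) C (hC i)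
      (fun x => ∑ k, (H i (ω k) x - ∫ a, H i a x ∂P)) (by
        have h1 := mean_meas P (H i) (hH i)
        have h2 : ∀ a, Measurable (fun x => H i a x) := fun a =>
          (hH i).comp (by fun_prop : Measurable fun x => (a, x))
        fun_prop) (∑ k : Fin m, (C + C)) (fun x => by
          refine (Finset.abs_sum_le_sum_abs _ _).trans (Finset.sum_le_sum fun k _ => ?_)
          exact (abs_sub _ _).trans (add_le_add (hC i _ _) (bdd_mean P _ C (fun a => hC i a x))))
    have hint : Integrable (fun a => α * ∑ i, ∫ x, (∑ k, (H i (ω k) x - ∫ a, H i a x ∂P) +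
        (H i a x - ∫ a, H i a x ∂P)) ^ 2 ∂μ + β * N a) P :=
      ((integrable_finsetSum _ fun i _ => (hs i).1).const_mul α).add (hN.const_mul β)
    obtain ⟨a, ha⟩ := exists_le_integral hint
    refine ⟨Fin.snoc ω a, ?_⟩
    simp only [Fin.sum_univ_castSucc, Fin.snoc_castSucc, Fin.snoc_last]
    rw [integral_add ((integrable_finsetSum _ fun i _ => (hs i).1).const_mul α) (hN.const_mul β),
      integral_const_mul, integral_const_mul, integral_finsetSum _ fun i _ => (hs i).1] at ha
    have := Finset.sum_le_sum fun i (_ : i ∈ Finset.univ) => (hs i).2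
    rw [Finset.sum_add_distrib] at this
    have := mul_le_mul_of_nonneg_left this hα
    push_cast
    linarith

lemma mean_weak {d : ℕ} (P : Measure A) [IsProbabilityMeasure P] (Ω : Set (Fin d → ℝ))
    [IsFiniteMeasure (volume.restrict Ω)]
    (H H' : A → (Fin d → ℝ) → ℝ) (hH : Measurable (Function.uncurry H))
    (hH' : Measurable (Function.uncurry H')) (C : ℝ) (hC : ∀ a x, |H a x| ≤ C)
    (hC' : ∀ a x, |H' a x| ≤ C) (j : Fin d) (hw : ∀ a, HasWeakPartial Ω (H a) j (H' a)) :
    HasWeakPartial Ω (fun x => ∫ a, H a x ∂P) j (fun x => ∫ a, H' a x ∂P) := by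
  intro φ hφ hφc hφΩ
  have key : ∀ (K : A → (Fin d → ℝ) → ℝ) (_ : Measurable (Function.uncurry K))
      (_ : ∀ a x, |K a x| ≤ C) (ψ : (Fin d → ℝ) → ℝ) (_ : Continuous ψ) (_ : HasCompactSupport ψ),
      ∫ x in Ω, (∫ a, K a x ∂P) * ψ x = ∫ a, (∫ x in Ω, K a x * ψ x) ∂P := by
    intro K hK hKC ψ hψ hψc
    obtain ⟨B, hB⟩ := hψc.exists_bound_of_continuous hψ
    rw [integral_integral_swap]
    · congr 1 with x
      rw [integral_mul_const]
    · apply bdd_int _ _ _ (C * B)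
      · rintro ⟨a, x⟩
        simp only [Function.uncurry_apply_pair]
        rw [abs_mul]
        exact mul_le_mul (hKC a x) (hB x) (abs_nonneg _) ((abs_nonneg _).trans (hKC a x))
      · have : Measurable (fun p : A × (Fin d → ℝ) => K p.1 p.2) := hK
        have := hψ.measurable
        simp only [Function.uncurry_def]
        fun_prop
  rw [key H hH hC (fun x => fderiv ℝ φ x (Pi.single j 1))
    ((hφ.continuous_fderiv (by simp)).clm_apply continuous_const)
    ((hφc.fderiv ℝ).comp_left (g := fun l : (Fin d → ℝ) →L[ℝ] ℝ => l (Pi.single j 1)) rfl),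
    key H' hH' hC' φ hφ.continuous hφc, ← integral_neg]
  congr 1 with a
  exact hw a φ hφ hφc hφΩ

end greedy

lemma l1_nonneg {d : ℕ} (ξ : Fin d → ℝ) : 0 ≤ l1 ξ := Finset.sum_nonneg fun i _ => abs_nonneg _

lemma l1_cont {d : ℕ} : Continuous (l1 (d := d)) := by unfold l1; fun_prop

def rneg {d : ℕ} (ξ : Fin d → ℝ) : ℝ := ∑ i, max 0 (-ξ i)

def tau {d : ℕ} (θ : (Fin d → ℝ) → ℝ) (ξ : Fin d → ℝ) : ℝ := rneg ξ + Int.fract (θ ξ - rneg ξ)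

def nn {d : ℕ} (ξ : Fin d → ℝ) : ℕ := ⌈Real.logb 2 (1 + l1 ξ)⌉₊

def HH {d : ℕ} (B : ℝ) (θ : (Fin d → ℝ) → ℝ) (i : Option (Fin d)) (a : (Fin d → ℝ) × unitInterval)
    (x : Fin d → ℝ) : ℝ :=
  match i with
  | none => B / (1 + l1 a.1) * gfun (nn a.1) a.2 ((∑ i, a.1 i * x i) + tau θ a.1)
  | some j => B / (1 + l1 a.1) * a.1 j *
      deriv (gfun (nn a.1) a.2) ((∑ i, a.1 i * x i) + tau θ a.1)

lemma nn_meas {d : ℕ} : Measurable (nn (d := d)) := by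
  unfold nn
  refine Nat.measurable_ceil.comp ?_
  have := (l1_cont (d := d)).measurable
  unfold Real.logb
  fun_prop

lemma tau_meas {d : ℕ} {θ : (Fin d → ℝ) → ℝ} (hθ : Measurable θ) : Measurable (tau θ) := by
  unfold tau
  have h1 : Measurable (rneg (d := d)) := by
    have : Continuous (rneg (d := d)) := by unfold rneg; fun_prop
    exact this.measurable
  exact h1.add (measurable_fract.comp (hθ.sub h1))

lemma HH_meas {d : ℕ} (B : ℝ) {θ : (Fin d → ℝ) → ℝ} (hθ : Measurable θ) (i : Option (Fin d)) :
    Measurable (Function.uncurry (HH B θ i)) := by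
  have h1 := nn_meas (d := d)
  have h2 := tau_meas hθ
  have h3 := (l1_cont (d := d)).measurable
  have h4 : Measurable (fun p : ((Fin d → ℝ) × unitInterval) × (Fin d → ℝ) =>
      (((nn p.1.1, (p.1.2 : ℝ)), (∑ i, p.1.1 i * p.2 i) + tau θ p.1.1) : (ℕ × ℝ) × ℝ)) := by
    fun_prop
  cases i with
  | none =>
    have h5 := gfun_cont.measurable.comp h4
    refine Measurable.mul ?_ h5
    fun_prop
  | some j =>
    have h5 := gfun_deriv_meas.comp h4
    refine Measurable.mul ?_ h5
    fun_prop

lemma pi_sq_ge : 1 ≤ Real.pi ^ 2 := by nlinarith [Real.pi_gt_three]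

lemma HH_sq {d : ℕ} (B : ℝ) (θ : (Fin d → ℝ) → ℝ) (a : (Fin d → ℝ) × unitInterval)
    (x : Fin d → ℝ) : ∑ i, HH B θ i a x ^ 2 ≤ 4 * Real.pi ^ 4 * B ^ 2 := by
  obtain ⟨ξ, s⟩ := a
  have hl := l1_nonneg ξ
  set t := (∑ i, ξ i * x i) + tau θ ξ with ht
  have h1 : gfun (nn ξ) s t ^ 2 ≤ 4 * Real.pi ^ 4 := by
    rw [← sq_abs]
    have := gfun_bound (nn ξ) s.2.1 t
    have h2 : |gfun (nn ξ) s t| ≤ 2 * Real.pi ^ 2 := by linarith [pi_sq_ge]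
    calc _ ≤ (2 * Real.pi ^ 2) ^ 2 := by gcongr
      _ = _ := by ring
  have h2 : deriv (gfun (nn ξ) s) t ^ 2 ≤ 4 * Real.pi ^ 4 := by
    rw [← sq_abs]
    have h2 := gfun_deriv_bound (nn ξ) s t
    calc _ ≤ (2 * Real.pi ^ 2) ^ 2 := by gcongr
      _ = _ := by ring
  have h3 : ∑ j, ξ j ^ 2 ≤ l1 ξ ^ 2 := by
    unfold l1
    have := Finset.sum_sq_le_sq_sum_of_nonneg (s := Finset.univ) (f := fun i => |ξ i|)
      (fun i _ => abs_nonneg _)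
    simpa using this
  rw [Fintype.sum_option]
  simp only [HH, ← ht]
  have e : ∀ j, (B / (1 + l1 ξ) * ξ j * deriv (gfun (nn ξ) s) t) ^ 2 =
    (B / (1 + l1 ξ)) ^ 2 * deriv (gfun (nn ξ) s) t ^ 2 * ξ j ^ 2 := fun j => by ring
  simp_rw [e, ← Finset.mul_sum, mul_pow]
  calc _ ≤ (B / (1 + l1 ξ)) ^ 2 * (4 * Real.pi ^ 4) +
        (B / (1 + l1 ξ)) ^ 2 * (4 * Real.pi ^ 4) * l1 ξ ^ 2 := by gcongr
    _ = 4 * Real.pi ^ 4 * B ^ 2 * ((1 + l1 ξ ^ 2) / (1 + l1 ξ) ^ 2) := by rw [div_pow]; ring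
    _ ≤ 4 * Real.pi ^ 4 * B ^ 2 * 1 := by
      gcongr
      rw [div_le_one (by positivity)]
      nlinarith
    _ = _ := by ring

lemma HH_bound {d : ℕ} (B : ℝ) (hB : 0 ≤ B) (θ : (Fin d → ℝ) → ℝ) (i : Option (Fin d))
    (a : (Fin d → ℝ) × unitInterval) (x : Fin d → ℝ) : |HH B θ i a x| ≤ 2 * Real.pi ^ 2 * B := by
  apply abs_le_of_sq_le_sq _ (by positivity)
  have := Finset.single_le_sum (f := fun i => HH B θ i a x ^ 2) (fun i _ => sq_nonneg _)
    (Finset.mem_univ i)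
  have h2 := HH_sq B θ a x
  nlinarith

lemma nn_bound {d : ℕ} (ξ : Fin d → ℝ) : (nn ξ : ℝ) + 2 ≤ 3 * Real.logb 2 (2 + l1 ξ) := by
  have hl := l1_nonneg ξ
  rcases le_or_gt (l1 ξ) 1 with h | h
  · have h1 : nn ξ ≤ 1 := by
      unfold nn
      rw [Nat.ceil_le, Nat.cast_one]
      calc _ ≤ Real.logb 2 2 := Real.logb_le_logb_of_le (by norm_num) (by positivity) (by linarith)
        _ = 1 := by simp
    have h2 : (1:ℝ) ≤ Real.logb 2 (2 + l1 ξ) := by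
      calc (1:ℝ) = Real.logb 2 2 := by simp
        _ ≤ _ := Real.logb_le_logb_of_le (by norm_num) (by positivity) (by linarith)
    have h3 : (nn ξ : ℝ) ≤ 1 := by exact_mod_cast h1
    linarith
  · have h1 : (nn ξ : ℝ) < Real.logb 2 (1 + l1 ξ) + 1 :=
      Nat.ceil_lt_add_one (Real.logb_nonneg (by norm_num) (by linarith))
    have h2 : Real.logb 2 (1 + l1 ξ) ≤ Real.logb 2 (2 + l1 ξ) :=
      Real.logb_le_logb_of_le (by norm_num) (by positivity) (by linarith)
    have h3 : (3:ℝ) ≤ 2 * Real.logb 2 (2 + l1 ξ) := by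
      have : (3:ℝ) = Real.logb 2 (2 ^ 3) := by
        rw [Real.logb_pow]; simp
      have e : (2:ℝ) * Real.logb 2 (2 + l1 ξ) = Real.logb 2 ((2 + l1 ξ) ^ 2) := by
        rw [Real.logb_pow]; simp
      rw [this, e]
      exact Real.logb_le_logb_of_le (by norm_num) (by positivity) (by nlinarith)
    linarith

lemma t_range {d : ℕ} (θ : (Fin d → ℝ) → ℝ) (ξ x : Fin d → ℝ) (hx : x ∈ Set.Icc (0 : Fin d → ℝ) 1) :
    0 ≤ (∑ i, ξ i * x i) + tau θ ξ ∧ (∑ i, ξ i * x i) + tau θ ξ ≤ 2 ^ nn ξ := by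
  have h0 := Int.fract_nonneg (θ ξ - rneg ξ)
  have h1 := (Int.fract_lt_one (θ ξ - rneg ξ)).le
  have e : (∑ i, ξ i * x i) + rneg ξ = ∑ i, (ξ i * x i + max 0 (-ξ i)) := by
    rw [Finset.sum_add_distrib]; rfl
  have h2 : 0 ≤ (∑ i, ξ i * x i) + rneg ξ := by
    rw [e]
    refine Finset.sum_nonneg fun i _ => ?_
    have a0 := hx.1 i
    have a1 := hx.2 i
    simp only [Pi.zero_apply, Pi.one_apply] at a0 a1
    rcases max_cases 0 (-ξ i) with h | h <;> rw [h.1] <;> nlinarith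
  have h3 : (∑ i, ξ i * x i) + rneg ξ ≤ l1 ξ := by
    rw [e, l1]
    refine Finset.sum_le_sum fun i _ => ?_
    have a0 := hx.1 i
    have a1 := hx.2 i
    simp only [Pi.zero_apply, Pi.one_apply] at a0 a1
    rcases max_cases 0 (-ξ i) with h | h <;> rcases abs_cases (ξ i) with k | k <;>
      rw [h.1, k.1] <;> nlinarith
  have h4 : 1 + l1 ξ ≤ 2 ^ nn ξ := by
    have hl := l1_nonneg ξ
    have : Real.logb 2 (1 + l1 ξ) ≤ nn ξ := Nat.le_ceil _
    rw [Real.logb_le_iff_le_rpow (by norm_num) (by linarith), Real.rpow_natCast] at this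
    exact this
  unfold tau
  constructor <;> linarith

lemma cos_tau {d : ℕ} (θ : (Fin d → ℝ) → ℝ) (ξ : Fin d → ℝ) (y : ℝ) :
    Real.cos (2 * Real.pi * (y + tau θ ξ)) = Real.cos (2 * Real.pi * (y + θ ξ)) := by
  unfold tau Int.fract
  rw [← Real.cos_sub_int_mul_two_pi (2 * Real.pi * (y + θ ξ)) ⌊θ ξ - rneg ξ⌋]
  ring_nf

lemma int_gfun {d : ℕ} (θ : (Fin d → ℝ) → ℝ) (ξ x : Fin d → ℝ)
    (hx : x ∈ Set.Icc (0 : Fin d → ℝ) 1) :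
    ∫ s : unitInterval, gfun (nn ξ) s ((∑ i, ξ i * x i) + tau θ ξ) =
      Real.cos (2 * Real.pi * ((∑ i, ξ i * x i) + θ ξ)) := by
  obtain ⟨h0, h1⟩ := t_range θ ξ x hx
  have e := integral_subtype_comap (μ := volume) (measurableSet_Icc (a := (0:ℝ)) (b := 1))
    (fun s => gfun (nn ξ) s ((∑ i, ξ i * x i) + tau θ ξ))
  rw [← cos_tau, ← cos_gw _ h0 h1]
  refine e.trans ?_
  have hm := tent_iter_mem (nn ξ + 1) (v := ((∑ i, ξ i * x i) + tau θ ξ) / 2 ^ nn ξ) (by positivity)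
    ((div_le_one (by positivity)).2 h1)
  exact integral_cos_relu hm.1 hm.2

lemma HH_weak {d : ℕ} (B : ℝ) (θ : (Fin d → ℝ) → ℝ) (Ω : Set (Fin d → ℝ)) (j : Fin d)
    (a : (Fin d → ℝ) × unitInterval) :
    HasWeakPartial Ω (HH B θ none a) j (HH B θ (some j) a) :=
  weak_ridge Ω (gfun (nn a.1) a.2) _ (gfun_lip _ _) a.1 (tau θ a.1) (B / (1 + l1 a.1)) j

lemma good_sum {d : ℕ} (B : ℝ) (θ : (Fin d → ℝ) → ℝ) (m : ℕ)
    (ω : Fin m → (Fin d → ℝ) × unitInterval) :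
    Good (∑ k, (nn (ω k).1 + 2)) (fun x => ∑ k, HH B θ none (ω k) x) := by
  induction m with
  | zero => simpa using good_zero
  | succ m ih =>
    simp only [Fin.sum_univ_castSucc]
    exact (ih (fun k => ω k.castSucc)).add (nn (ω (Fin.last m)).1) _ _ _ _ (ω (Fin.last m)).2.2.1

lemma weak_comb {d m : ℕ} (Ω : Set (Fin d → ℝ)) [IsFiniteMeasure (volume.restrict Ω)]
    (C : ℝ) (u u' : (Fin d → ℝ) → ℝ) (K K' : Fin m → (Fin d → ℝ) → ℝ)
    (hu : Measurable u) (hu' : Measurable u') (hK : ∀ k, Measurable (K k))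
    (hK' : ∀ k, Measurable (K' k)) (bu : ∀ x, |u x| ≤ C) (bu' : ∀ x, |u' x| ≤ C)
    (bK : ∀ k x, |K k x| ≤ C) (bK' : ∀ k x, |K' k x| ≤ C) (c : ℝ) (j : Fin d)
    (h : HasWeakPartial Ω u j u') (hk : ∀ k, HasWeakPartial Ω (K k) j (K' k)) :
    HasWeakPartial Ω (fun x => u x - c * ∑ k, K k x) j (fun x => u' x - c * ∑ k, K' k x) := by
  intro φ hφ hφc hφΩ
  have key : ∀ (w : (Fin d → ℝ) → ℝ) (_ : Measurable w) (_ : ∀ x, |w x| ≤ C)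
      (ψ : (Fin d → ℝ) → ℝ) (_ : Continuous ψ) (_ : HasCompactSupport ψ),
      Integrable (fun x => w x * ψ x) (volume.restrict Ω) := by
    intro w hw hwC ψ hψ hψc
    obtain ⟨B, hB⟩ := hψc.exists_bound_of_continuous hψ
    refine bdd_int _ _ (hw.mul hψ.measurable) (C * B) fun y => ?_
    rw [abs_mul]
    exact mul_le_mul (hwC y) (hB y) (abs_nonneg _) ((abs_nonneg _).trans (hwC y))
  have comb : ∀ (w : (Fin d → ℝ) → ℝ) (_ : Measurable w) (_ : ∀ x, |w x| ≤ C)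
      (W : Fin m → (Fin d → ℝ) → ℝ) (_ : ∀ k, Measurable (W k)) (_ : ∀ k x, |W k x| ≤ C)
      (ψ : (Fin d → ℝ) → ℝ) (_ : Continuous ψ) (_ : HasCompactSupport ψ),
      ∫ x in Ω, (w x - c * ∑ k, W k x) * ψ x =
        (∫ x in Ω, w x * ψ x) - c * ∑ k, ∫ x in Ω, W k x * ψ x := by
    intro w hw hwC W hW hWC ψ hψ hψc
    have e : ∀ x, (w x - c * ∑ k, W k x) * ψ x = w x * ψ x - c * ∑ k, W k x * ψ x := by
      intro x; rw [sub_mul, mul_assoc, Finset.sum_mul]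
    simp_rw [e]
    have hi : ∀ k ∈ Finset.univ, Integrable (fun x => W k x * ψ x) (volume.restrict Ω) :=
      fun k _ => key _ (hW k) (hWC k) ψ hψ hψc
    rw [integral_sub (key w hw hwC ψ hψ hψc) ((integrable_finsetSum _ hi).const_mul c),
      integral_const_mul, integral_finsetSum _ hi]
  have hd : Continuous (fun x => fderiv ℝ φ x (Pi.single j 1)) :=
    (hφ.continuous_fderiv (by simp)).clm_apply continuous_const
  have hdc : HasCompactSupport (fun x => fderiv ℝ φ x (Pi.single j 1)) :=
    hφc.fderiv_apply ℝ _
  rw [comb u hu bu K hK bK _ hd hdc, comb u' hu' bu' K' hK' bK' _ hφ.continuous hφc,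
    h φ hφ hφc hφΩ]
  simp_rw [fun k => hk k φ hφ hφc hφΩ]
  rw [Finset.sum_neg_distrib]
  ring

lemma weak_congr {d : ℕ} (Ω : Set (Fin d → ℝ)) (u w v : (Fin d → ℝ) → ℝ) (j : Fin d)
    (h : u =ᵐ[volume.restrict Ω] w) (hw : HasWeakPartial Ω w j v) : HasWeakPartial Ω u j v := by
  intro φ hφ hφc hφΩ
  rw [← hw φ hφ hφc hφΩ]
  refine integral_congr_ae ?_
  filter_upwards [h] with x hx
  rw [hx]

def rho {d : ℕ} (g : (Fin d → ℝ) → ℂ) (ξ : Fin d → ℝ) : ℝ := (1 + l1 ξ) * ‖g ξ‖ / B1 g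

def P0 {d : ℕ} (g : (Fin d → ℝ) → ℂ) : Measure (Fin d → ℝ) :=
  volume.withDensity (fun ξ => ENNReal.ofReal (rho g ξ))

lemma one_le_logb {d : ℕ} (ξ : Fin d → ℝ) : 1 ≤ Real.logb 2 (2 + l1 ξ) := by
  have hl := l1_nonneg ξ
  calc (1:ℝ) = Real.logb 2 2 := by simp
    _ ≤ _ := Real.logb_le_logb_of_le (by norm_num) (by positivity) (by linarith)

lemma int_B1 {d : ℕ} (g : (Fin d → ℝ) → ℂ) (hg : Continuous g)
    (h : Integrable (fun ξ => (1 + l1 ξ) * Real.logb 2 (2 + l1 ξ) * ‖g ξ‖)) :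
    Integrable (fun ξ => (1 + l1 ξ) * ‖g ξ‖) := by
  have hl := l1_cont (d := d)
  refine h.mono' (by fun_prop) (ae_of_all _ fun ξ => ?_)
  have h1 := l1_nonneg ξ
  have h2 := one_le_logb ξ
  rw [Real.norm_of_nonneg (by positivity)]
  gcongr
  nlinarith

lemma rho_nonneg {d : ℕ} (g : (Fin d → ℝ) → ℂ) (hB : 0 < B1 g) (ξ : Fin d → ℝ) :
    0 ≤ rho g ξ := by
  have h1 := l1_nonneg ξ
  unfold rho; positivity

lemma rho_cont {d : ℕ} (g : (Fin d → ℝ) → ℂ) (hg : Continuous g) : Continuous (rho g) := by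
  have hl := l1_cont (d := d)
  unfold rho; fun_prop

lemma P0_prob {d : ℕ} (g : (Fin d → ℝ) → ℂ) (hg : Continuous g) (hB : 0 < B1 g)
    (h : Integrable (fun ξ => (1 + l1 ξ) * Real.logb 2 (2 + l1 ξ) * ‖g ξ‖)) :
    IsProbabilityMeasure (P0 g) := by
  constructor
  have hi : Integrable (rho g) := (int_B1 g hg h).div_const _
  rw [P0, withDensity_apply _ MeasurableSet.univ, Measure.restrict_univ,
    ← ofReal_integral_eq_lintegral_ofReal hi (ae_of_all _ (rho_nonneg g hB))]
  unfold rho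
  rw [integral_div]
  change ENNReal.ofReal (B1 g / B1 g) = 1
  rw [div_self hB.ne', ENNReal.ofReal_one]

lemma P0_int {d : ℕ} (g : (Fin d → ℝ) → ℂ) (hg : Continuous g) (hB : 0 < B1 g)
    (u : (Fin d → ℝ) → ℝ) : ∫ ξ, u ξ ∂(P0 g) = ∫ ξ, rho g ξ * u ξ := by
  unfold P0
  rw [integral_withDensity_eq_integral_toReal_smul
    (rho_cont g hg).measurable.ennreal_ofReal (by simp)]
  simp_rw [ENNReal.toReal_ofReal (rho_nonneg g hB _), smul_eq_mul]

lemma P0_integrable {d : ℕ} (g : (Fin d → ℝ) → ℂ) (hg : Continuous g) (hB : 0 < B1 g)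
    (u : (Fin d → ℝ) → ℝ) (h : Integrable (fun ξ => rho g ξ * u ξ)) : Integrable u (P0 g) := by
  unfold P0
  rw [integrable_withDensity_iff_integrable_smul'
    (rho_cont g hg).measurable.ennreal_ofReal (by simp)]
  simp_rw [ENNReal.toReal_ofReal (rho_nonneg g hB _), smul_eq_mul]
  exact h

lemma logN {d : ℕ} (g : (Fin d → ℝ) → ℂ) (hg : Continuous g) (hB : 0 < B1 g)
    (h : Integrable (fun ξ => (1 + l1 ξ) * Real.logb 2 (2 + l1 ξ) * ‖g ξ‖)) :
    Integrable (fun a : (Fin d → ℝ) × unitInterval => 3 * Real.logb 2 (2 + l1 a.1))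
      ((P0 g).prod volume) ∧
    ∫ a : (Fin d → ℝ) × unitInterval, 3 * Real.logb 2 (2 + l1 a.1) ∂((P0 g).prod volume) =
      3 * (B1log g / B1 g) := by
  have := P0_prob g hg hB h
  have e : ∀ ξ, rho g ξ * Real.logb 2 (2 + l1 ξ) =
      (1 + l1 ξ) * Real.logb 2 (2 + l1 ξ) * ‖g ξ‖ / B1 g := by
    intro ξ; unfold rho; ring
  have h1 : Integrable (fun ξ : Fin d → ℝ => Real.logb 2 (2 + l1 ξ)) (P0 g) := by
    apply P0_integrable g hg hB
    simp_rw [e]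
    exact h.div_const _
  have h2 : Integrable (fun a : (Fin d → ℝ) × unitInterval => 3 * Real.logb 2 (2 + l1 a.1))
      ((P0 g).prod volume) := (h1.comp_fst (volume : Measure unitInterval)).const_mul 3
  refine ⟨h2, ?_⟩
  rw [integral_prod _ h2]
  simp only [integral_const, probReal_univ, one_smul]
  rw [integral_const_mul, P0_int g hg hB]
  simp_rw [e]
  rw [integral_div]
  rfl

def ph {d : ℕ} (g : (Fin d → ℝ) → ℂ) (ξ : Fin d → ℝ) : ℝ := Complex.arg (g ξ) / (2 * Real.pi)

lemma ph_meas {d : ℕ} (g : (Fin d → ℝ) → ℂ) (hg : Continuous g) : Measurable (ph g) :=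
  (Complex.measurable_arg.comp hg.measurable).div_const _

lemma mean_none {d : ℕ} (g : (Fin d → ℝ) → ℂ) (hg : Continuous g) (hB : 0 < B1 g)
    (h : Integrable (fun ξ => (1 + l1 ξ) * Real.logb 2 (2 + l1 ξ) * ‖g ξ‖))
    (x : Fin d → ℝ) (hx : x ∈ Set.Icc (0 : Fin d → ℝ) 1) :
    ∫ a, HH (B1 g) (ph g) none a x ∂((P0 g).prod volume) =
      ∫ ξ, ‖g ξ‖ * Real.cos (2 * Real.pi * ((∑ i, ξ i * x i) + ph g ξ)) := by
  have := P0_prob g hg hB h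
  have hi : Integrable (fun a => HH (B1 g) (ph g) none a x) ((P0 g).prod volume) := by
    exact bdd_int _ _ (HH_meas (B1 g) (ph_meas g hg) none).of_uncurry_right _
      (fun a => HH_bound (B1 g) hB.le (ph g) none a x)
  rw [integral_prod _ hi]
  simp only [HH]
  simp_rw [integral_const_mul, int_gfun (ph g) _ x hx]
  rw [P0_int g hg hB]
  refine integral_congr_ae (ae_of_all _ fun ξ => ?_)
  have h1 := l1_nonneg ξ
  have h2 : 1 + l1 ξ ≠ 0 := by positivity
  have h3 := hB.ne'
  simp only [rho]
  field_simp

lemma re_inv {d : ℕ} (g : (Fin d → ℝ) → ℂ) (hg : Continuous g) (hgi : Integrable g)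
    (x : Fin d → ℝ) :
    (∫ ξ : Fin d → ℝ, Complex.exp (2 * (Real.pi : ℂ) * Complex.I *
      ((∑ i, ξ i * x i : ℝ) : ℂ)) * g ξ).re =
      ∫ ξ, ‖g ξ‖ * Real.cos (2 * Real.pi * ((∑ i, ξ i * x i) + ph g ξ)) := by
  have hi : Integrable (fun ξ : Fin d → ℝ => Complex.exp (2 * (Real.pi : ℂ) * Complex.I *
      ((∑ i, ξ i * x i : ℝ) : ℂ)) * g ξ) := by
    refine hgi.norm.mono' (by fun_prop) (ae_of_all _ fun ξ => ?_)
    rw [norm_mul]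
    have : ‖Complex.exp (2 * (Real.pi : ℂ) * Complex.I * ((∑ i, ξ i * x i : ℝ) : ℂ))‖ = 1 := by
      rw [show (2 * (Real.pi : ℂ) * Complex.I * ((∑ i, ξ i * x i : ℝ) : ℂ)) =
        ((2 * Real.pi * ∑ i, ξ i * x i : ℝ) : ℂ) * Complex.I by push_cast; ring]
      exact Complex.norm_exp_ofReal_mul_I _
    rw [this, one_mul]
  have := (integral_re (𝕜 := ℂ) hi)
  change (∫ ξ, (_ : ℂ).re) = _ at this
  refine this.symm.trans ?_
  refine integral_congr_ae (ae_of_all _ fun ξ => ?_)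
  simp only [RCLike.re_eq_complex_re]
  conv_lhs => rw [← Complex.norm_mul_exp_arg_mul_I (g ξ)]
  rw [mul_left_comm, ← Complex.exp_add,
    show (2 * (Real.pi : ℂ) * Complex.I * ((∑ i, ξ i * x i : ℝ) : ℂ)) +
      (Complex.arg (g ξ) : ℂ) * Complex.I =
        ((2 * Real.pi * ((∑ i, ξ i * x i) + ph g ξ) : ℝ) : ℂ) * Complex.I by
      have hp : (Real.pi : ℂ) ≠ 0 := by exact_mod_cast Real.pi_ne_zero
      unfold ph
      push_cast
      field_simp,
    Complex.re_ofReal_mul, Complex.exp_ofReal_mul_I_re]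

/-- If `f : ℝ^d → ℝ` has `f̂ ∈ L¹`, `‖f‖_{B^{1,log}} < ∞` and
`‖f‖_{B¹} > 0`, then for every compact `Ω ⊆ [0,1]^d` and `m ≥ 1` there is a single ReLU
network `F` of width `d+4` and depth at most `6m ‖f‖_{B^{1,log}}/‖f‖_{B¹}` such that
`f - F` has weak partials `v_j` on `Ω` and
`‖f - F‖_{H¹(Ω)} ≤ (4π²/√m)|Ω|^{1/2}‖f‖_{B¹}` (stated as the equivalent squared bound). -/
theorem H1_approx_unit_cube_deep (d : ℕ) (f : (Fin d → ℝ) → ℝ)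
    (hf1 : Integrable (fhatR f))
    (hf1log : Integrable (fun ξ => (1 + l1 ξ) * Real.logb 2 (2 + l1 ξ) * ‖fhatR f ξ‖))
    (hB1 : 0 < B1 (fhatR f))
    (Ω : Set (Fin d → ℝ)) (hΩc : IsCompact Ω) (hΩ : Ω ⊆ Set.Icc 0 1)
    (m : ℕ) (hm : 0 < m) :
    ∃ (L : ℕ) (F : (Fin d → ℝ) → ℝ) (v : Fin d → (Fin d → ℝ) → ℝ),
      IsReLUNet d (d + 4) L F ∧
      (L : ℝ) ≤ 6 * m * B1log (fhatR f) / B1 (fhatR f) ∧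
      (∀ j, HasWeakPartial Ω (fun x => f x - F x) j (v j)) ∧
      ((∫⁻ x in Ω, ENNReal.ofReal ((f x - F x) ^ 2)) +
        ∑ j : Fin d, ∫⁻ x in Ω, ENNReal.ofReal (v j x ^ 2)) ≤
        ENNReal.ofReal ((4 * Real.pi ^ 2 / Real.sqrt m *
          Real.sqrt ((volume Ω).toReal) * B1 (fhatR f)) ^ 2) := by
  set g := fhatR f with hgdef
  set B := B1 g with hBdef
  have hfi := fhat_ne_integrable f hB1
  have hg : Continuous g := fhat_cont _ hfi
  have hP0 := P0_prob g hg hB1 hf1log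
  set P : Measure ((Fin d → ℝ) × unitInterval) := (P0 g).prod volume with hP
  have : IsFiniteMeasure (volume.restrict Ω) :=
    isFiniteMeasure_restrict.2 hΩc.measure_lt_top.ne
  have hπ := Real.pi_pos
  have hm' : (0:ℝ) < m := by exact_mod_cast hm
  set θ := ph g with hθ
  have hθm : Measurable θ := ph_meas g hg
  set C := 2 * Real.pi ^ 2 * B with hC
  have hHm := fun i => HH_meas B hθm i
  have hHb : ∀ i a x, |HH B θ i a x| ≤ C := fun i a x => HH_bound B hB1.le θ i a x
  set V := (volume Ω).toReal with hV
  have hV0 : 0 ≤ V := ENNReal.toReal_nonneg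
  set ℓ := B1log g / B with hℓ
  obtain ⟨hN, hNi⟩ := logN g hg hB1 hf1log
  have hℓ1 : 1 ≤ ℓ := by
    rw [hℓ, one_le_div hB1]
    refine integral_mono (int_B1 g hg hf1log) hf1log fun ξ => ?_
    have h1 := l1_nonneg ξ
    have h2 := one_le_logb ξ
    have h3 := norm_nonneg (g ξ)
    dsimp only
    gcongr
    nlinarith
  set D := 16 * Real.pi ^ 4 * B ^ 2 with hD
  have hD0 : 0 < D := by positivity
  set α := 1 / (D * V) with hα
  have hα0 : 0 ≤ α := by positivity
  obtain ⟨ω, hω⟩ := greedy P (volume.restrict Ω) (HH B θ) hHm C hHb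
    (fun a => 3 * Real.logb 2 (2 + l1 a.1)) hN α (1 / (4 * ℓ)) hα0 m
  rw [hNi] at hω
  set Q := ∑ i, ∫ x in Ω, (∑ k, (HH B θ i (ω k) x - ∫ a, HH B θ i a x ∂P)) ^ 2 with hQ
  have hQ0 : 0 ≤ Q := Finset.sum_nonneg fun i _ => integral_nonneg fun x => sq_nonneg _
  have hsq : ∀ i a, Integrable (fun x => HH B θ i a x ^ 2) (volume.restrict Ω) := by
    intro i a
    refine bdd_int _ _ ((hHm i).of_uncurry_left.pow_const 2) (C ^ 2) fun x => ?_
    rw [abs_pow]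
    exact pow_le_pow_left₀ (abs_nonneg _) (hHb i a x) 2
  have hsqP : ∀ i, Integrable (fun a => ∫ x in Ω, HH B θ i a x ^ 2) P := by
    intro i
    have : Integrable (fun p : ((Fin d → ℝ) × unitInterval) × (Fin d → ℝ) => HH B θ i p.1 p.2 ^ 2)
        (P.prod (volume.restrict Ω)) := by
      refine bdd_int _ _ ((hHm i).pow_const 2) (C ^ 2) fun x => ?_
      rw [abs_pow]
      exact pow_le_pow_left₀ (abs_nonneg _) (hHb i _ _) 2
    exact this.integral_prod_left
  have hS : ∑ i, ∫ a, (∫ x in Ω, HH B θ i a x ^ 2) ∂P ≤ D / 4 * V := by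
    rw [← integral_finsetSum _ fun i _ => hsqP i]
    have h1 : ∀ a, ∑ i, ∫ x in Ω, HH B θ i a x ^ 2 ≤ D / 4 * V := by
      intro a
      rw [← integral_finsetSum _ fun i _ => hsq i a]
      calc _ ≤ ∫ x in Ω, D / 4 := by
            refine integral_mono (integrable_finsetSum _ fun i _ => hsq i a)
              (integrable_const _) fun x => ?_
            refine (HH_sq B θ a x).trans (le_of_eq ?_)
            rw [hD]; ring
        _ = _ := by
            rw [integral_const, smul_eq_mul, mul_comm]
            simp [Measure.real, hV]
    calc _ ≤ ∫ a, D / 4 * V ∂P :=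
          integral_mono (integrable_finsetSum _ fun i _ => hsqP i) (integrable_const _) h1
      _ = _ := by simp
  have hαS : α * ∑ i, ∫ a, (∫ x in Ω, HH B θ i a x ^ 2) ∂P ≤ 1 / 4 := by
    refine (mul_le_mul_of_nonneg_left hS hα0).trans ?_
    rcases hV0.eq_or_lt with h | h
    · rw [← h]; simp
    · rw [hα]; apply le_of_eq; field_simp
  have hβ : 1 / (4 * ℓ) * (3 * ℓ) = 3 / 4 := by field_simp
  have hω2 : α * Q + 1 / (4 * ℓ) * ∑ k, 3 * Real.logb 2 (2 + l1 (ω k).1) ≤ m := by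
    refine hω.trans ?_
    calc _ ≤ (m:ℝ) * 1 := by
          refine mul_le_mul_of_nonneg_left ?_ hm'.le
          rw [hβ]; linarith
      _ = _ := mul_one _
  set T := ∑ k, 3 * Real.logb 2 (2 + l1 (ω k).1) with hT
  have hT0 : 0 ≤ T := Finset.sum_nonneg fun k _ => by linarith [one_le_logb (ω k).1]
  have hTm : T ≤ 4 * m * ℓ := by
    have h1 : 1 / (4 * ℓ) * T ≤ m := by nlinarith [mul_nonneg hα0 hQ0]
    have h2 : T = (4 * ℓ) * (1 / (4 * ℓ) * T) := by field_simp
    rw [h2]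
    nlinarith
  have hQm : Q ≤ D * V * m := by
    rcases hV0.eq_or_lt with h | h
    · have : volume.restrict Ω = 0 := by
        rw [Measure.restrict_eq_zero]
        have := h.symm
        rw [hV, ENNReal.toReal_eq_zero_iff] at this
        exact this.resolve_right hΩc.measure_lt_top.ne
      rw [hQ, this]
      simp [← h]
    · have h1 : α * Q ≤ m := by
        have : 0 ≤ 1 / (4 * ℓ) * T := by positivity
        linarith
      rw [hα, one_div, inv_mul_le_iff₀ (by positivity)] at h1
      exact h1
  obtain ⟨F, hF, hFx⟩ := (good_sum B θ m ω).net (1 / m)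
  set h : Option (Fin d) → (Fin d → ℝ) → ℝ := fun i x => ∫ a, HH B θ i a x ∂P with hh
  have hhm : ∀ i, Measurable (h i) := fun i => mean_meas P _ (hHm i)
  have hhb : ∀ i x, |h i x| ≤ C := fun i x => bdd_mean P _ C fun a => hHb i a x
  set E : Option (Fin d) → (Fin d → ℝ) → ℝ :=
    fun i x => h i x - 1 / m * ∑ k, HH B θ i (ω k) x with hE
  have hae : (fun x => f x - F x) =ᵐ[volume.restrict Ω] E none := by
    have h1 := inv_ae _ hfi hf1
    filter_upwards [ae_restrict_of_ae h1, ae_restrict_mem hΩc.measurableSet] with x hx hxΩ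
    rw [hFx x (hΩ hxΩ)]
    simp only [hE, hh]
    rw [mean_none g hg hB1 hf1log x (hΩ hxΩ), ← re_inv g hg hf1 x]
    have := congrArg Complex.re hx
    rw [Complex.ofReal_re] at this
    rw [this]
    rfl
  have hEsq : ∀ i, ∫⁻ x in Ω, ENNReal.ofReal (E i x ^ 2) = ENNReal.ofReal (∫ x in Ω, E i x ^ 2) := by
    intro i
    rw [ofReal_integral_eq_lintegral_ofReal]
    · have hmE : Measurable (E i) :=
        (hhm i).sub ((Finset.measurable_sum _ fun k _ => (hHm i).of_uncurry_left).const_mul _)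
      refine bdd_int _ _ (hmE.pow_const 2) ((C + 1 / m * ∑ k : Fin m, C) ^ 2) fun x => ?_
      rw [abs_pow]
      refine pow_le_pow_left₀ (abs_nonneg _) ?_ 2
      refine (abs_sub _ _).trans (add_le_add (hhb i x) ?_)
      rw [abs_mul, abs_of_nonneg (by positivity : (0:ℝ) ≤ 1 / m)]
      refine mul_le_mul_of_nonneg_left ?_ (by positivity)
      exact (Finset.abs_sum_le_sum_abs _ _).trans (Finset.sum_le_sum fun k _ => hHb i _ x)
    · exact ae_of_all _ fun x => sq_nonneg _
  have hEQ : ∑ i, ∫ x in Ω, E i x ^ 2 = Q / m ^ 2 := by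
    rw [hQ, Finset.sum_div]
    refine Finset.sum_congr rfl fun i _ => ?_
    rw [← integral_div]
    refine integral_congr_ae (ae_of_all _ fun x => ?_)
    simp only [hE, hh]
    rw [Finset.sum_sub_distrib, Finset.sum_const, Finset.card_univ, Fintype.card_fin, nsmul_eq_mul]
    field_simp
    ring
  refine ⟨_, F, fun j => E (some j), hF, ?_, fun j => ?_, ?_⟩
  · have h1 : ((∑ k, (nn (ω k).1 + 2) + 2 : ℕ) : ℝ) ≤ T + 2 := by
      push_cast
      have : ∑ k, ((nn (ω k).1 : ℝ) + 2) ≤ T := Finset.sum_le_sum fun k _ => nn_bound _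
      linarith
    refine h1.trans ?_
    have h2 : 6 * m * B1log g / B = 6 * m * ℓ := by rw [hℓ]; ring
    rw [h2]
    have h3 : (1:ℝ) ≤ m := by exact_mod_cast hm
    nlinarith
  · refine weak_congr Ω _ _ _ j hae ?_
    exact weak_comb Ω C (h none) (h (some j)) (fun k => HH B θ none (ω k))
      (fun k => HH B θ (some j) (ω k)) (hhm _) (hhm _) (fun k => (hHm _).of_uncurry_left)
      (fun k => (hHm _).of_uncurry_left) (hhb _) (hhb _) (fun k => hHb _ _) (fun k => hHb _ _)
      (1 / m) j
      (mean_weak P Ω _ _ (hHm none) (hHm (some j)) C (hHb _) (hHb _) j (HH_weak B θ Ω j))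
      (fun k => HH_weak B θ Ω j (ω k))
  · have e : ∫⁻ x in Ω, ENNReal.ofReal ((f x - F x) ^ 2) = ∫⁻ x in Ω, ENNReal.ofReal (E none x ^ 2) := by
      refine lintegral_congr_ae ?_
      filter_upwards [hae] with x hx
      rw [hx]
    rw [e]
    simp_rw [hEsq]
    rw [← ENNReal.ofReal_sum_of_nonneg (fun i _ => integral_nonneg fun x => sq_nonneg _),
      ← ENNReal.ofReal_add (integral_nonneg fun x => sq_nonneg _)
        (Finset.sum_nonneg fun i _ => integral_nonneg fun x => sq_nonneg _)]
    apply ENNReal.ofReal_le_ofReal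
    have h1 := hEQ
    rw [Fintype.sum_option] at h1
    rw [h1]
    have h2 : (4 * Real.pi ^ 2 / Real.sqrt m * Real.sqrt V * B) ^ 2 = D * V / m := by
      rw [mul_pow, mul_pow, div_pow, Real.sq_sqrt hm'.le, Real.sq_sqrt hV0, hD]
      ring
    rw [h2, div_le_div_iff₀ (by positivity) hm']
    nlinarith

end
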